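/- Let (W,S) be a finite Coxeter system and R its family of R-polynomials. For all u ≤ w in Bruhat order, the shifted R-polynomial R⃗_{u,w}(q) = R_{u,w}(q+1) has nonnegative integer coefficients and is monic of degree ℓ(u,w). -/

import Mathlib

open Polynomial

/-- A Bruhat edge `u → v`: `v = u * t` for some reflection `t`, and `ℓ(u) < ℓ(v)`. -/
def BruhatEdge {B W : Type*} [Group W] {M : CoxeterMatrix B}
    (cs : CoxeterSystem M W) (u v : W) : Prop :=
  ∃ t : W, cs.IsReflection t ∧ v = u * t ∧ cs.length u < cs.length v

/-- Bruhat order: the reflexive-transitive closure of the Bruhat edge relation. -/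
def BruhatLE {B W : Type*} [Group W] {M : CoxeterMatrix B}
    (cs : CoxeterSystem M W) : W → W → Prop :=
  Relation.ReflTransGen (BruhatEdge cs)

/-- The defining properties of the family of `R`-polynomials. -/
def IsRFamily {B W : Type*} [Group W] {M : CoxeterMatrix B}
    (cs : CoxeterSystem M W) (R : W → W → Polynomial ℤ) : Prop :=
  (∀ u w, ¬ BruhatLE cs u w → R u w = 0) ∧
  (∀ w, R w w = 1) ∧
  (∀ u w, ∀ i : B, cs.length (w * cs.simple i) < cs.length w →
    (cs.length (u * cs.simple i) < cs.length u →
      R u w = R (u * cs.simple i) (w * cs.simple i)) ∧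
    (cs.length u < cs.length (u * cs.simple i) →
      R u w = (X - 1) * R u (w * cs.simple i)
        + X * R (u * cs.simple i) (w * cs.simple i)))

/-- The defining properties of the family of `R̃`-polynomials. -/
def IsRTildeFamily {B W : Type*} [Group W] {M : CoxeterMatrix B}
    (cs : CoxeterSystem M W) (Rt : W → W → Polynomial ℕ) : Prop :=
  (∀ u w, ¬ BruhatLE cs u w → Rt u w = 0) ∧
  (∀ w, Rt w w = 1) ∧
  (∀ u w, ∀ i : B, cs.length (w * cs.simple i) < cs.length w →
    (cs.length (u * cs.simple i) < cs.length u →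
      Rt u w = Rt (u * cs.simple i) (w * cs.simple i)) ∧
    (cs.length u < cs.length (u * cs.simple i) →
      Rt u w = X * Rt u (w * cs.simple i)
        + Rt (u * cs.simple i) (w * cs.simple i)))

/-- Dihedral polynomials. -/
noncomputable def dPoly : ℕ → Polynomial ℤ
  | 0 => 1
  | 1 => X
  | 2 => X ^ 2
  | (n + 3) => X * dPoly (n + 2) + (X + 1) * dPoly (n + 1)

/-- The degree of a vertex `x` in the Bruhat graph on the vertex set `V`:
the total number of incident edges (incoming plus outgoing). -/
noncomputable def degIn {B W : Type*} [Group W] {M : CoxeterMatrix B}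
    (cs : CoxeterSystem M W) (V : Set W) (x : W) : ℕ :=
  Nat.card {y : W // y ∈ V ∧ (BruhatEdge cs x y ∨ BruhatEdge cs y x)}

/-- The Bruhat graph on the vertex set `V` is regular: all vertices have the same degree. -/
def IsRegularOn {B W : Type*} [Group W] {M : CoxeterMatrix B}
    (cs : CoxeterSystem M W) (V : Set W) : Prop :=
  ∀ x ∈ V, ∀ y ∈ V, degIn cs V x = degIn cs V y

namespace CoxeterSystem

variable {B W : Type*} [Group W] {M : CoxeterMatrix B} (cs : CoxeterSystem M W)

open Classical in
/-- The involution `(t, ε) ↦ (s t s, ε + [t = s])` attached to a simple reflection `s`. -/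
noncomputable def inversionInvolution (i : B) : Equiv.Perm (W × ZMod 2) :=
  Function.Involutive.toPerm
    (fun p ↦ (cs.simple i * p.1 * cs.simple i, p.2 + if p.1 = cs.simple i then 1 else 0)) <| by
    rintro ⟨t, ε⟩
    have h : cs.simple i * t * cs.simple i = cs.simple i ↔ t = cs.simple i := by
      constructor
      · intro h
        have h' := congrArg (fun x ↦ cs.simple i * x * cs.simple i) h
        simpa [mul_assoc] using h'
      · rintro rfl
        simp
    simp only [h, Prod.mk.injEq]
    refine ⟨by simp [mul_assoc], ?_⟩
    rw [add_assoc, CharTwo.add_self_eq_zero, add_zero]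

open Classical in
theorem inversionInvolution_apply (i : B) (t : W) (ε : ZMod 2) :
    cs.inversionInvolution i (t, ε) =
      (cs.simple i * t * cs.simple i, ε + if t = cs.simple i then 1 else 0) := rfl

open Classical in
theorem inversionInvolution_mul_pow_apply (i j : B) (k : ℕ) (t : W) (ε : ZMod 2) :
    ((cs.inversionInvolution i * cs.inversionInvolution j) ^ k) (t, ε) =
      ((cs.simple i * cs.simple j) ^ k * t * ((cs.simple i * cs.simple j) ^ k)⁻¹,
        ε + ∑ n ∈ Finset.range (2 * k),
          if t = cs.simple j * (cs.simple i * cs.simple j) ^ n then 1 else 0) := by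
  induction k with
  | zero => simp
  | succ k ih =>
    rw [pow_succ', Equiv.Perm.mul_apply, ih, Equiv.Perm.mul_apply, inversionInvolution_apply,
      inversionInvolution_apply]
    set a := cs.simple i
    set b := cs.simple j
    have hb : b⁻¹ = b := cs.inv_simple j
    have ha : a⁻¹ = a := cs.inv_simple i
    have hbb : b * b = 1 := cs.simple_mul_simple_self j
    have hinv : (a * b)⁻¹ = b * a := by rw [mul_inv_rev, ha, hb]
    have hsemi : ∀ n : ℕ, b * (a * b) ^ n = ((a * b) ^ n)⁻¹ * b := by
      intro n
      have h : SemiconjBy b (a * b) (a * b)⁻¹ := by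
        rw [SemiconjBy, hinv, mul_assoc]
      simpa only [SemiconjBy, inv_pow] using (h.pow_right n).eq
    have conj_iff : ∀ c : W, (a * b) ^ k * t * ((a * b) ^ k)⁻¹ = c ↔
        t = ((a * b) ^ k)⁻¹ * c * (a * b) ^ k := by
      intro c
      constructor
      · rintro rfl
        group
      · rintro rfl
        group
    have h1 : (a * b) ^ k * t * ((a * b) ^ k)⁻¹ = b ↔ t = b * (a * b) ^ (2 * k) := by
      rw [conj_iff, ← hsemi, mul_assoc, ← pow_add, two_mul]
    have h2 : b * ((a * b) ^ k * t * ((a * b) ^ k)⁻¹) * b = a ↔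
        t = b * (a * b) ^ (2 * k + 1) := by
      have : b * ((a * b) ^ k * t * ((a * b) ^ k)⁻¹) * b = a ↔
          (a * b) ^ k * t * ((a * b) ^ k)⁻¹ = b * (a * b) := by
        constructor
        · intro h
          have h' := congrArg (fun x ↦ b * x * b) h
          simpa [b, mul_assoc] using h'
        · intro h
          rw [h]
          simp only [mul_assoc, hbb, mul_one]
          rw [← mul_assoc b b, hbb, one_mul]
      rw [this, conj_iff, ← mul_assoc, ← hsemi, mul_assoc, mul_assoc, ← pow_succ', ← pow_add]
      congr! 3
      omega
    simp only [h1, h2]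
    refine Prod.ext ?_ ?_
    · simp only [pow_succ' (a * b) k, mul_inv_rev, ha, hb, mul_assoc]
    · rw [mul_add, Finset.sum_range_succ, Finset.sum_range_succ]
      simp only [add_assoc]

open Classical in
theorem isLiftable_inversionInvolution : M.IsLiftable cs.inversionInvolution := by
  intro i j
  have hp : (cs.simple i * cs.simple j) ^ M i j = 1 := cs.simple_mul_simple_pow i j
  generalize M i j = m at hp ⊢
  ext1 ⟨t, ε⟩
  rw [inversionInvolution_mul_pow_apply, two_mul, Finset.sum_range_add]
  have h : ∀ n, (cs.simple i * cs.simple j) ^ (m + n) = (cs.simple i * cs.simple j) ^ n := by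
    simp [pow_add, hp]
  rw [Finset.sum_congr rfl (s₁ := Finset.range m)
    (f := fun n ↦ if t = cs.simple j * (cs.simple i * cs.simple j) ^ (m + n)
      then (1 : ZMod 2) else 0)
    (fun n _ ↦ by rw [h]), hp, CharTwo.add_self_eq_zero]
  simp

/-- The action of `W` on `W × ZMod 2` recording parities of inversion counts. -/
noncomputable def inversionAction : W →* Equiv.Perm (W × ZMod 2) :=
  cs.lift ⟨cs.inversionInvolution, cs.isLiftable_inversionInvolution⟩

theorem inversionAction_simple (i : B) :
    cs.inversionAction (cs.simple i) = cs.inversionInvolution i :=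
  cs.lift_apply_simple cs.isLiftable_inversionInvolution i

open Classical in
theorem inversionAction_wordProd (ω : List B) (t : W) (ε : ZMod 2) :
    cs.inversionAction (cs.wordProd ω) (t, ε) =
      (cs.wordProd ω * t * (cs.wordProd ω)⁻¹, ε + ((cs.rightInvSeq ω).count t : ℕ)) := by
  induction ω with
  | nil => simp
  | cons i ω ih =>
    rw [wordProd_cons, map_mul, Equiv.Perm.mul_apply, ih, inversionAction_simple,
      inversionInvolution_apply, rightInvSeq, List.count_cons]
    refine Prod.ext ?_ ?_
    · simp [mul_assoc]
    · have h : cs.wordProd ω * t * (cs.wordProd ω)⁻¹ = cs.simple i ↔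
          (cs.wordProd ω)⁻¹ * cs.simple i * cs.wordProd ω = t := by
        constructor
        · intro h
          rw [← h]
          group
        · rintro rfl
          group
      simp only [h, beq_iff_eq]
      split_ifs <;> simp [add_assoc]

/-- The parity of the number of occurrences of `t` in the right inversion sequence
of any word for `w`. -/
noncomputable def inversionParity (w t : W) : ZMod 2 := (cs.inversionAction w (t, 0)).2

theorem inversionAction_apply (w t : W) (ε : ZMod 2) :
    cs.inversionAction w (t, ε) = (w * t * w⁻¹, ε + cs.inversionParity w t) := by
  obtain ⟨ω, rfl⟩ := cs.wordProd_surjective w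
  simp [inversionParity, inversionAction_wordProd]

theorem inversionParity_mul (v w t : W) :
    cs.inversionParity (v * w) t =
      cs.inversionParity w t + cs.inversionParity v (w * t * w⁻¹) := by
  conv_lhs => rw [inversionParity, map_mul, Equiv.Perm.mul_apply, inversionAction_apply,
    inversionAction_apply]
  simp

theorem inversionParity_one (t : W) : cs.inversionParity 1 t = 0 := by
  simp [inversionParity]

open Classical in
theorem inversionParity_simple (i : B) (t : W) :
    cs.inversionParity (cs.simple i) t = if t = cs.simple i then 1 else 0 := by
  simp [inversionParity, inversionAction_simple, inversionInvolution_apply]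

theorem IsReflection.inversionParity_self {t : W} (ht : cs.IsReflection t) :
    cs.inversionParity t t = 1 := by
  obtain ⟨v, i, rfl⟩ := ht
  have h := cs.inversionParity_mul v v⁻¹ (v * cs.simple i * v⁻¹)
  rw [mul_inv_cancel, inversionParity_one] at h
  rw [inversionParity_mul, inversionParity_mul]
  have e : v⁻¹ * (v * cs.simple i * v⁻¹) * v⁻¹⁻¹ = cs.simple i := by group
  rw [e] at h ⊢
  simp only [mul_inv_cancel_right, inversionParity_simple, if_true]
  linear_combination -h

theorem isRightInversion_of_inversionParity_ne_zero {w t : W} (h : cs.inversionParity w t ≠ 0) :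
    cs.IsRightInversion w t := by
  classical
  obtain ⟨ω, hω, rfl⟩ := cs.exists_isReduced w
  refine cs.isRightInversion_of_mem_rightInvSeq hω ?_
  by_contra hmem
  simp [inversionParity, inversionAction_wordProd, List.count_eq_zero_of_not_mem hmem] at h

/-- A form of the strong exchange property. -/
theorem IsReflection.length_mul_lt_iff {t : W} (ht : cs.IsReflection t) (w : W) :
    cs.length (w * t) < cs.length w ↔ cs.inversionParity w t ≠ 0 := by
  refine ⟨fun hlt h ↦ ?_, fun h ↦ (cs.isRightInversion_of_inversionParity_ne_zero h).2⟩
  have h' : cs.inversionParity (w * t) t ≠ 0 := by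
    rw [inversionParity_mul, ht.inversionParity_self, mul_inv_cancel_right, h]
    simp
  have := (cs.isRightInversion_of_inversionParity_ne_zero h').2
  rw [mul_assoc, ht.mul_self, mul_one] at this
  omega

end CoxeterSystem

namespace BruhatEdge

variable {B W : Type*} [Group W] {M : CoxeterMatrix B} {cs : CoxeterSystem M W}

theorem mul_simple {u v : W} (h : BruhatEdge cs u v) (i : B) (hne : v ≠ u * cs.simple i) :
    BruhatEdge cs (u * cs.simple i) (v * cs.simple i) := by
  obtain ⟨t, ht, rfl, hlt⟩ := h
  have hts : t ≠ cs.simple i := fun h ↦ hne (by rw [h])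
  have hr : cs.IsReflection (cs.simple i * t * cs.simple i) := by
    simpa using ht.conj (cs.simple i)
  have he : u * t * cs.simple i = u * cs.simple i * (cs.simple i * t * cs.simple i) := by
    simp [mul_assoc]
  refine ⟨_, hr, he, ?_⟩
  have h0 : ¬ cs.length (u * t) < cs.length u := hlt.not_gt
  rw [ht.length_mul_lt_iff] at h0
  have h1 : ¬ cs.length (u * cs.simple i * (cs.simple i * t * cs.simple i)) <
      cs.length (u * cs.simple i) := by
    rw [hr.length_mul_lt_iff, cs.inversionParity_mul, cs.inversionParity_simple, if_neg]
    · simpa [mul_assoc] using h0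
    · intro h
      apply hts
      simpa [mul_assoc] using congrArg (fun x ↦ cs.simple i * x * cs.simple i) h
  rw [he]
  exact lt_of_le_of_ne (not_lt.mp h1) (hr.length_mul_left_ne _).symm

theorem of_length_lt_mul_simple {u : W} {i : B}
    (h : cs.length u < cs.length (u * cs.simple i)) : BruhatEdge cs u (u * cs.simple i) :=
  ⟨_, cs.isReflection_simple i, rfl, h⟩

theorem of_length_mul_simple_lt {u : W} {i : B}
    (h : cs.length (u * cs.simple i) < cs.length u) : BruhatEdge cs (u * cs.simple i) u :=
  ⟨_, cs.isReflection_simple i, by simp, h⟩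

end BruhatEdge

namespace BruhatLE

variable {B W : Type*} [Group W] {M : CoxeterMatrix B} {cs : CoxeterSystem M W}

theorem length_le {u w : W} (h : BruhatLE cs u w) : cs.length u ≤ cs.length w := by
  induction h with
  | refl => exact le_rfl
  | tail _ h ih =>
    obtain ⟨_, _, _, hlt⟩ := h
    omega

/-- The lifting property: passing to the shorter element of each coset of `⟨s⟩` is monotone. -/
theorem min_mul_simple {u w : W} (h : BruhatLE cs u w) (i : B) :
    BruhatLE cs (if cs.length (u * cs.simple i) < cs.length u then u * cs.simple i else u)
      (if cs.length (w * cs.simple i) < cs.length w then w * cs.simple i else w) := by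
  induction h with
  | refl => exact .refl
  | @tail x y _ h ih =>
    refine Relation.ReflTransGen.trans ih ?_
    by_cases hy : y = x * cs.simple i
    · subst hy
      obtain ⟨_, _, _, hlt⟩ := h
      rw [if_neg hlt.not_gt, if_pos (by simpa using hlt)]
      simpa using Relation.ReflTransGen.refl
    have h' := h.mul_simple i hy
    split_ifs with hx hw hw
    · exact .single h'
    · exact .tail (.single (.of_length_mul_simple_lt hx)) h
    · refine .tail (.single (.of_length_lt_mul_simple ?_)) h'
      exact lt_of_le_of_ne (not_lt.mp hx) (cs.length_mul_simple_ne x i).symm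
    · exact .single h

end BruhatLE

theorem stmt3 {B W : Type*} [Group W] [Finite W] {M : CoxeterMatrix B}
    (cs : CoxeterSystem M W)
    (R : W → W → Polynomial ℤ) (hR : IsRFamily cs R)
    (u w : W) (huw : BruhatLE cs u w) :
    (∀ m : ℕ, 0 ≤ ((R u w).comp (X + 1)).coeff m) ∧
    ((R u w).comp (X + 1)).Monic ∧
    ((R u w).comp (X + 1)).natDegree = cs.length w - cs.length u := by
  obtain ⟨hzero, hone, hrec⟩ := hR
  induction hn : cs.length w generalizing u w with
  | zero =>
    have hw : w = 1 := cs.length_eq_zero_iff.mp hn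
    have hu : u = 1 := cs.length_eq_zero_iff.mp (by have := huw.length_le; omega)
    subst hw hu
    simp only [hone, one_comp, natDegree_one, monic_one, true_and, coeff_one]
    exact ⟨fun m ↦ by split_ifs <;> simp, by simp⟩
  | succ n ih =>
    have hw : w ≠ 1 := by
      rintro rfl
      simp at hn
    obtain ⟨i, hi⟩ := cs.exists_rightDescent_of_ne_one hw
    have hlift := huw.min_mul_simple i
    have hlw := cs.isRightDescent_iff.mp hi
    rw [if_pos (c := cs.length (w * cs.simple i) < cs.length w) hi] at hlift
    obtain ⟨hdown, hup⟩ := hrec u w i hi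
    have hws : cs.length (w * cs.simple i) = n := by omega
    rcases cs.length_mul_simple u i with hu | hu
    · rw [if_neg (by omega)] at hlift
      have hle := hlift.length_le
      obtain ⟨hc, hm, hd⟩ := ih u _ hlift hws
      rw [hup (by omega)]
      set P := (R u (w * cs.simple i)).comp (X + 1)
      set Q := (R (u * cs.simple i) (w * cs.simple i)).comp (X + 1) with hQ
      have hPQ : ((X - 1) * R u (w * cs.simple i) +
          X * R (u * cs.simple i) (w * cs.simple i)).comp (X + 1) = X * P + (X + 1) * Q := by
        simp [P, Q]
      rw [hPQ]
      have hXm : (X * P).Monic := monic_X.mul hm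
      have hXd : (X * P).natDegree = n + 1 - cs.length u := by
        rw [monic_X.natDegree_mul hm, natDegree_X, hd]
        omega
      have hXc : ∀ m, 0 ≤ (X * P).coeff m := by
        rintro (_ | m)
        · simp
        · simpa [coeff_X_mul] using hc m
      by_cases hle' : BruhatLE cs (u * cs.simple i) (w * cs.simple i)
      · obtain ⟨hc', hm', hd'⟩ := ih _ _ hle' hws
        have hlen := hle'.length_le
        have hlt : ((X + 1) * Q).degree < (X * P).degree := by
          have hX1 : (X + 1 : ℤ[X]).Monic := monic_X_add_C 1
          refine degree_lt_degree ?_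
          rw [hXd, hX1.natDegree_mul hm', hd', ← C_1, natDegree_X_add_C]
          omega
        refine ⟨fun m ↦ ?_, hXm.add_of_left hlt, ?_⟩
        · rw [coeff_add]
          refine add_nonneg (hXc m) ?_
          rw [add_mul, one_mul, coeff_add]
          refine add_nonneg ?_ (hc' m)
          rcases m with _ | m
          · simp
          · simpa [coeff_X_mul] using hc' m
        · rw [natDegree_add_eq_left_of_degree_lt hlt, hXd]
      · have : Q = 0 := by rw [hQ, hzero _ _ hle', zero_comp]
        rw [this, mul_zero, add_zero]
        exact ⟨hXc, hXm, hXd⟩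
    · rw [if_pos (by omega)] at hlift
      obtain ⟨hc, hm, hd⟩ := ih _ _ hlift hws
      rw [hdown (by omega)]
      exact ⟨hc, hm, by rw [hd]; omega⟩
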